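/- Let T be a tree with diameter 5 consisting of a root vertex v_0 adjacent to p ≥ 0 leaves, to r − 1 ≥ 1 vertices v_1, …, v_{r−1} each of which is additionally adjacent to s_i ≥ 1 leaves, and to exactly one vertex w' whose only other neighbor is a vertex w that is additionally adjacent to t ≥ 1 leaves (so n = p + r + 2 + t + s_1 + ⋯ + s_{r−1}). Let σ be the number of Laplacian eigenvalues of T strictly larger than the average degree d̄ = 2 − 2/n. Then σ = r + 1 or σ = r + 2. -/

import Mathlib

open Polynomial

namespace LapPaper

variable {V : Type} [Fintype V] [DecidableEq V]

/-- The multiset of Laplacian eigenvalues of `G` (with multiplicity), given as the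
real roots of the characteristic polynomial of the Laplacian matrix `L = D - A`. -/
noncomputable def lapSpectrum (G : SimpleGraph V) [DecidableRel G.Adj] : Multiset ℝ :=
  (G.lapMatrix ℝ).charpoly.roots

/-- The average degree `d̄ = 2|E|/n` of a graph. -/
noncomputable def avgDeg (G : SimpleGraph V) [DecidableRel G.Adj] : ℝ :=
  2 * G.edgeFinset.card / Fintype.card V

/-- The Laplacian energy `LE(G) = ∑_i |μ_i - d̄|`. -/
noncomputable def LE (G : SimpleGraph V) [DecidableRel G.Adj] : ℝ :=
  ((lapSpectrum G).map (fun x => |x - avgDeg G|)).sum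

/-- `Sk G k` is the sum of the `k` largest Laplacian eigenvalues `μ_1 + ⋯ + μ_k` of `G`. -/
noncomputable def Sk (G : SimpleGraph V) [DecidableRel G.Adj] (k : ℕ) : ℝ :=
  ((((lapSpectrum G).sort (· ≤ ·)).reverse).take k).sum

/-- The number `σ` of Laplacian eigenvalues of `G` strictly larger than the average degree. -/
noncomputable def sigma (G : SimpleGraph V) [DecidableRel G.Adj] : ℕ :=
  Multiset.card ((lapSpectrum G).filter (fun x => avgDeg G < x))

/-- The double star `T(a,b)` on `a + b + 2` vertices: vertex `0` is adjacent to vertex `1`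
and to the `a` leaves `2, …, a+1`; vertex `1` is adjacent to the `b` leaves `a+2, …, a+b+1`. -/
def doubleStar (a b : ℕ) : SimpleGraph (Fin (a + b + 2)) :=
  SimpleGraph.fromRel (fun u v =>
    (u.1 = 0 ∧ v.1 = 1) ∨ (u.1 = 0 ∧ 2 ≤ v.1 ∧ v.1 < a + 2) ∨ (u.1 = 1 ∧ a + 2 ≤ v.1))

noncomputable instance (a b : ℕ) : DecidableRel (doubleStar a b).Adj := Classical.decRel _

/-- The star on `n` vertices: vertex `0` is adjacent to all other vertices. -/
def starGraph (n : ℕ) : SimpleGraph (Fin n) :=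
  SimpleGraph.fromRel (fun u _ => u.1 = 0)

noncomputable instance (n : ℕ) : DecidableRel (starGraph n).Adj := Classical.decRel _

end LapPaper

namespace LapPaper

/-- The diameter-5 tree with a root `Sum.inl ()` adjacent to `q` pendant leaves, to `m`
vertices `v_i` each additionally adjacent to `s i` leaves, and to one vertex `w'`
(`Sum.inr (Sum.inr (Sum.inr (Sum.inl ())))`) whose only other neighbour `w` is
additionally adjacent to `t` leaves. -/
def diam5Tree (q m t : ℕ) (s : Fin m → ℕ) :
    SimpleGraph (Unit ⊕ (Fin q ⊕ ((Σ i : Fin m, Unit ⊕ Fin (s i)) ⊕ (Unit ⊕ (Unit ⊕ Fin t))))) :=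
  SimpleGraph.fromRel (fun u v =>
    (∃ j : Fin q, u = Sum.inl () ∧ v = Sum.inr (Sum.inl j)) ∨
    (∃ i : Fin m, u = Sum.inl () ∧ v = Sum.inr (Sum.inr (Sum.inl ⟨i, Sum.inl ()⟩))) ∨
    (∃ (i : Fin m) (j : Fin (s i)), u = Sum.inr (Sum.inr (Sum.inl ⟨i, Sum.inl ()⟩)) ∧
      v = Sum.inr (Sum.inr (Sum.inl ⟨i, Sum.inr j⟩))) ∨
    (u = Sum.inl () ∧ v = Sum.inr (Sum.inr (Sum.inr (Sum.inl ())))) ∨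
    (u = Sum.inr (Sum.inr (Sum.inr (Sum.inl ()))) ∧
      v = Sum.inr (Sum.inr (Sum.inr (Sum.inr (Sum.inl ()))))) ∨
    (∃ j : Fin t, u = Sum.inr (Sum.inr (Sum.inr (Sum.inr (Sum.inl ())))) ∧
      v = Sum.inr (Sum.inr (Sum.inr (Sum.inr (Sum.inr j))))))

noncomputable instance (q m t : ℕ) (s : Fin m → ℕ) : DecidableRel (diam5Tree q m t s).Adj :=
  Classical.decRel _

open Matrix in
theorem dotProduct_mulVec_eq_sum_eigenvalues {n : Type*} [Fintype n] [DecidableEq n]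
    {A : Matrix n n ℝ} (hA : A.IsHermitian) (f : n → ℝ) :
    f ⬝ᵥ (A *ᵥ f) =
      ∑ i, hA.eigenvalues i * (((hA.eigenvectorUnitary : Matrix n n ℝ)ᵀ *ᵥ f) i) ^ 2 := by
  have h := hA.spectral_theorem
  rw [Unitary.conjStarAlgAut_apply] at h
  conv_lhs => rw [h]
  rw [← mulVec_mulVec, ← mulVec_mulVec, dotProduct_mulVec, ← mulVec_transpose]
  simp only [dotProduct, star_eq_conjTranspose, conjTranspose_eq_transpose_of_trivial,
    mulVec_diagonal]
  refine Finset.sum_congr rfl fun i _ => ?_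
  simp
  ring

theorem card_le_card_pos_of_posDef {ι κ : Type*} [Fintype ι] [Fintype κ] (μ : κ → ℝ)
    (c : (ι → ℝ) →ₗ[ℝ] (κ → ℝ)) (hc : ∀ y, y ≠ 0 → 0 < ∑ i, μ i * (c y i) ^ 2) :
    Fintype.card ι ≤ Fintype.card {i // 0 < μ i} := by
  by_contra! h
  let F : (ι → ℝ) →ₗ[ℝ] ({i // 0 < μ i} → ℝ) := LinearMap.funLeft ℝ ℝ Subtype.val ∘ₗ c
  have hF : LinearMap.ker F ≠ ⊥ := F.ker_ne_bot_of_finrank_lt <| by simpa using h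
  obtain ⟨y, hy, hy0⟩ := (Submodule.ne_bot_iff _).mp hF
  refine (hc y hy0).not_ge (Finset.sum_nonpos fun i _ => ?_)
  by_cases hi : 0 < μ i
  · have : c y i = 0 := congrFun (LinearMap.mem_ker.mp hy) ⟨i, hi⟩
    simp [this]
  · exact mul_nonpos_of_nonpos_of_nonneg (not_lt.mp hi) (sq_nonneg _)

theorem sum_eigenvalues_sub_mul_sq {n : Type*} [Fintype n] [DecidableEq n]
    {A : Matrix n n ℝ} (hA : A.IsHermitian) (x : ℝ) (f : n → ℝ) :
    ∑ i, (hA.eigenvalues i - x) *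
      (((hA.eigenvectorUnitary : Matrix n n ℝ).transpose.mulVec f) i) ^ 2 =
      f ⬝ᵥ (A.mulVec f) - x * ∑ i, f i ^ 2 := by
  have h1 : ((hA.eigenvectorUnitary : Matrix n n ℝ).transpose.mulVec f) ⬝ᵥ
      ((hA.eigenvectorUnitary : Matrix n n ℝ).transpose.mulVec f) = f ⬝ᵥ f := by
    have hU := Unitary.mul_star_self_of_mem hA.eigenvectorUnitary.2
    rw [Matrix.star_eq_conjTranspose, Matrix.conjTranspose_eq_transpose_of_trivial] at hU
    rw [Matrix.mulVec_transpose, ← Matrix.dotProduct_mulVec, ← Matrix.mulVec_transpose,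
      Matrix.mulVec_mulVec, hU, Matrix.one_mulVec]
  simp only [dotProduct, ← pow_two] at h1
  rw [dotProduct_mulVec_eq_sum_eigenvalues hA, ← h1, Finset.mul_sum, ← Finset.sum_sub_distrib]
  exact Finset.sum_congr rfl fun i _ => by ring

theorem card_le_card_filter_roots_of_posDef {n ι : Type*} [Fintype n] [DecidableEq n] [Fintype ι]
    {A : Matrix n n ℝ} (hA : A.IsHermitian) (x : ℝ) (T : (ι → ℝ) →ₗ[ℝ] (n → ℝ))
    (hT : ∀ y, y ≠ 0 → x * ∑ i, T y i ^ 2 < T y ⬝ᵥ (A.mulVec (T y))) :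
    Fintype.card ι ≤ (A.charpoly.roots.filter (fun a => x < a)).card := by
  have := card_le_card_pos_of_posDef (fun i => hA.eigenvalues i - x)
    (Matrix.toLin' (hA.eigenvectorUnitary : Matrix n n ℝ).transpose ∘ₗ T) fun y hy => by
      simpa [sum_eigenvalues_sub_mul_sq] using hT y hy
  rw [hA.roots_charpoly_eq_eigenvalues, Multiset.filter_map, Multiset.card_map]
  simpa [Fintype.card_subtype, Finset.card_def] using this

theorem card_filter_roots_add_card_le_of_negDef {n ι : Type*} [Fintype n] [DecidableEq n]
    [Fintype ι] {A : Matrix n n ℝ} (hA : A.IsHermitian) (x : ℝ) (T : (ι → ℝ) →ₗ[ℝ] (n → ℝ))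
    (hT : ∀ y, y ≠ 0 → T y ⬝ᵥ (A.mulVec (T y)) < x * ∑ i, T y i ^ 2) :
    (A.charpoly.roots.filter (fun a => x < a)).card + Fintype.card ι ≤ Fintype.card n := by
  have h := card_le_card_pos_of_posDef (fun i => x - hA.eigenvalues i)
    (Matrix.toLin' (hA.eigenvectorUnitary : Matrix n n ℝ).transpose ∘ₗ T) fun y hy => by
      have := sum_eigenvalues_sub_mul_sq hA x (T y)
      have := hT y hy
      simp only [← neg_sub _ x, neg_mul, Finset.sum_neg_distrib]
      simp only [LinearMap.comp_apply, Matrix.toLin'_apply]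
      linarith
  have hroots : (A.charpoly.roots.filter (fun a => x < a)).card =
      Fintype.card {i // x < hA.eigenvalues i} := by
    rw [hA.roots_charpoly_eq_eigenvalues, Multiset.filter_map, Multiset.card_map]
    simp [Fintype.card_subtype, Finset.card_def]
  rw [hroots]
  have h2 : Fintype.card {i // 0 < x - hA.eigenvalues i} ≤
      Fintype.card {i // ¬ x < hA.eigenvalues i} :=
    Fintype.card_subtype_mono _ _ fun i hi => by
      have : 0 < x - hA.eigenvalues i := hi
      change ¬ x < hA.eigenvalues i
      linarith
  have h3 := Fintype.card_subtype_compl (fun i => x < hA.eigenvalues i)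
  have h4 := Fintype.card_subtype_le (fun i => x < hA.eigenvalues i)
  omega


open Classical in
theorem sum_sum_fromRel_sub_sq {W : Type*} [Fintype W] {G : SimpleGraph W} [DecidableRel G.Adj]
    {R : W → W → Prop} (hG : G = SimpleGraph.fromRel R) (hR : ∀ u v, R u v → ¬ R v u) (f : W → ℝ) :
    (∑ u, ∑ v, if G.Adj u v then (f u - f v) ^ 2 else 0) / 2 =
      ∑ u, ∑ v, if R u v then (f u - f v) ^ 2 else 0 := by
  have h (u v : W) : (if G.Adj u v then (f u - f v) ^ 2 else 0) =
      (if R u v then (f u - f v) ^ 2 else 0) + (if R v u then (f v - f u) ^ 2 else 0) := by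
    have h1 := hR u v
    have h2 : R u v → u ≠ v := fun h e => h1 h (e ▸ e ▸ h)
    have h3 : R v u → u ≠ v := fun h e => hR v u h (e ▸ e ▸ h)
    have h4 : G.Adj u v ↔ u ≠ v ∧ (R u v ∨ R v u) := by rw [hG, SimpleGraph.fromRel_adj]
    simp only [h4]
    by_cases ha : R u v
    · simp [ha, h1 ha, h2 ha]
    · by_cases hb : R v u
      · simp [ha, hb, h3 hb]
        ring
      · simp [ha, hb]
  simp only [h, Finset.sum_add_distrib]
  rw [Finset.sum_comm (f := fun u v => if R v u then (f v - f u) ^ 2 else 0)]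
  ring

theorem sum_sum_diam5Tree_sub_sq (q m t : ℕ) (s : Fin m → ℕ)
    (f : Unit ⊕ (Fin q ⊕ ((Σ i : Fin m, Unit ⊕ Fin (s i)) ⊕ (Unit ⊕ (Unit ⊕ Fin t)))) → ℝ) :
    (∑ u, ∑ v, if (diam5Tree q m t s).Adj u v then (f u - f v) ^ 2 else 0) / 2 =
      (∑ j, (f (.inl ()) - f (.inr (.inl j))) ^ 2) +
      (∑ i, ((f (.inl ()) - f (.inr (.inr (.inl ⟨i, .inl ()⟩)))) ^ 2 +
        ∑ j, (f (.inr (.inr (.inl ⟨i, .inl ()⟩))) - f (.inr (.inr (.inl ⟨i, .inr j⟩)))) ^ 2)) +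
      (f (.inl ()) - f (.inr (.inr (.inr (.inl ()))))) ^ 2 +
      (f (.inr (.inr (.inr (.inl ())))) - f (.inr (.inr (.inr (.inr (.inl ())))))) ^ 2 +
      ∑ j, (f (.inr (.inr (.inr (.inr (.inl ()))))) -
        f (.inr (.inr (.inr (.inr (.inr j)))))) ^ 2 := by
  classical
  have center_eq (x i : Fin m) (u : Unit) :
      (⟨x, .inl u⟩ : Σ i : Fin m, Unit ⊕ Fin (s i)) = ⟨i, .inl ()⟩ ↔ x = i :=
    ⟨fun h => congrArg Sigma.fst h, by rintro rfl; rfl⟩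
  have leaf_ne (x i : Fin m) (j : Fin (s x)) (u : Unit) :
      (⟨x, .inr j⟩ : Σ i : Fin m, Unit ⊕ Fin (s i)) ≠ ⟨i, .inl u⟩ := by
    intro h
    obtain rfl : x = i := congrArg Sigma.fst h
    simp at h
  have leaf_adj (x y : Fin m) (k : Fin (s y)) :
      (∃ (i : Fin m) (j : Fin (s i)), x = i ∧
        (⟨y, .inr k⟩ : Σ i : Fin m, Unit ⊕ Fin (s i)) = ⟨i, .inr j⟩) ↔ x = y :=
    ⟨by rintro ⟨i, j, rfl, h⟩; exact (congrArg Sigma.fst h).symm,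
      by rintro rfl; exact ⟨x, k, rfl, rfl⟩⟩
  rw [sum_sum_fromRel_sub_sq (G := diam5Tree q m t s) rfl]
  · simp only [Fintype.sum_sum_type, Fintype.sum_sigma, reduceCtorEq, Sum.inl.injEq, Sum.inr.injEq,
      center_eq, leaf_ne, fun x i j u => (leaf_ne x i j u).symm, leaf_adj,
      Finset.sum_ite_irrel, Finset.sum_ite_eq, Finset.mem_univ,
      false_and, and_false, exists_false, false_or, or_false, if_false, exists_eq',
      Finset.sum_const_zero, add_zero, zero_add, true_and, and_true, Finset.univ_unique,
      Finset.sum_singleton, if_true, PUnit.default_eq_unit, Finset.sum_add_distrib]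
    ring
  · rintro (_ | _ | ⟨i, _ | _⟩ | _ | _ | _) (_ | _ | ⟨i, _ | _⟩ | _ | _ | _) <;>
      simp [-Sigma.mk.injEq, leaf_ne, fun x i j u => (leaf_ne x i j u).symm]

/-- The test vectors on which the Laplacian form exceeds `2 - ε` times the squared norm: every leaf
carries the negative of its neighbour's value, and `w'` the negative of the root's value. -/
def coreVectors (q m t : ℕ) (s : Fin m → ℕ) : (Unit ⊕ Fin m ⊕ Unit → ℝ) →ₗ[ℝ]
    (Unit ⊕ (Fin q ⊕ ((Σ i : Fin m, Unit ⊕ Fin (s i)) ⊕ (Unit ⊕ (Unit ⊕ Fin t)))) → ℝ) where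
  toFun y := Sum.elim (fun _ => y (.inl ())) <| Sum.elim (fun _ => -y (.inl ())) <|
    Sum.elim (fun w =>
      Sum.elim (fun _ => y (.inr (.inl w.1))) (fun _ => -y (.inr (.inl w.1))) w.2) <|
    Sum.elim (fun _ => -y (.inl ())) <|
    Sum.elim (fun _ => y (.inr (.inr ()))) (fun _ => -y (.inr (.inr ())))
  map_add' y z := by
    ext (_ | _ | ⟨i, _ | _⟩ | _ | _ | _) <;> simp [add_comm]
  map_smul' c y := by
    ext (_ | _ | ⟨i, _ | _⟩ | _ | _ | _) <;> simp

/-- The vectors supported on the leaves. -/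
def leafVectors (q m t : ℕ) (s : Fin m → ℕ) :
    (Fin q ⊕ (Σ i : Fin m, Fin (s i)) ⊕ Fin t → ℝ) →ₗ[ℝ]
    (Unit ⊕ (Fin q ⊕ ((Σ i : Fin m, Unit ⊕ Fin (s i)) ⊕ (Unit ⊕ (Unit ⊕ Fin t)))) → ℝ) where
  toFun y := Sum.elim (fun _ => 0) <| Sum.elim (fun j => y (.inl j)) <|
    Sum.elim (fun w => Sum.elim (fun _ => 0) (fun j => y (.inr (.inl ⟨w.1, j⟩))) w.2) <|
    Sum.elim (fun _ => 0) <| Sum.elim (fun _ => 0) (fun j => y (.inr (.inr j)))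
  map_add' y z := by
    ext (_ | _ | ⟨i, _ | _⟩ | _ | _ | _) <;> simp
  map_smul' c y := by
    ext (_ | _ | ⟨i, _ | _⟩ | _ | _ | _) <;> simp

theorem dotProduct_lapMatrix_mulVec_diam5Tree (q m t : ℕ) (s : Fin m → ℕ)
    (f : Unit ⊕ (Fin q ⊕ ((Σ i : Fin m, Unit ⊕ Fin (s i)) ⊕ (Unit ⊕ (Unit ⊕ Fin t)))) → ℝ) :
    f ⬝ᵥ (((diam5Tree q m t s).lapMatrix ℝ).mulVec f) =
      (∑ j, (f (.inl ()) - f (.inr (.inl j))) ^ 2) +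
      (∑ i, ((f (.inl ()) - f (.inr (.inr (.inl ⟨i, .inl ()⟩)))) ^ 2 +
        ∑ j, (f (.inr (.inr (.inl ⟨i, .inl ()⟩))) - f (.inr (.inr (.inl ⟨i, .inr j⟩)))) ^ 2)) +
      (f (.inl ()) - f (.inr (.inr (.inr (.inl ()))))) ^ 2 +
      (f (.inr (.inr (.inr (.inl ())))) - f (.inr (.inr (.inr (.inr (.inl ())))))) ^ 2 +
      ∑ j, (f (.inr (.inr (.inr (.inr (.inl ()))))) -
        f (.inr (.inr (.inr (.inr (.inr j)))))) ^ 2 := by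
  rw [← Matrix.toLinearMap₂'_apply', SimpleGraph.lapMatrix_toLinearMap₂', sum_sum_diam5Tree_sub_sq]

theorem lt_dotProduct_lapMatrix_mulVec_coreVectors (q m t : ℕ) (s : Fin m → ℕ) (ht : 1 ≤ t)
    (hs : ∀ i, 1 ≤ s i) {ε : ℝ} (hε : 0 < ε) (y : Unit ⊕ Fin m ⊕ Unit → ℝ) (hy : y ≠ 0) :
    (2 - ε) * ∑ v, coreVectors q m t s y v ^ 2 <
      coreVectors q m t s y ⬝ᵥ
        (((diam5Tree q m t s).lapMatrix ℝ).mulVec (coreVectors q m t s y)) := by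
  rw [dotProduct_lapMatrix_mulVec_diam5Tree]
  have hpos : 0 < ∑ k, y k ^ 2 := by
    obtain ⟨k, hk⟩ := Function.ne_iff.mp hy
    exact Finset.sum_pos' (fun _ _ => sq_nonneg _) ⟨k, Finset.mem_univ k, sq_pos_of_ne_zero hk⟩
  simp only [Fintype.sum_sum_type, Finset.univ_unique, Finset.sum_singleton,
    PUnit.default_eq_unit] at hpos
  have hsum : (2 - ε) * ∑ i, (y (.inr (.inl i)) ^ 2 + s i * y (.inr (.inl i)) ^ 2) +
      ε * ∑ i, y (.inr (.inl i)) ^ 2 ≤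
      ∑ i, ((y (.inl ()) - y (.inr (.inl i))) ^ 2 + s i * (2 * y (.inr (.inl i))) ^ 2) := by
    rw [Finset.mul_sum, Finset.mul_sum, ← Finset.sum_add_distrib]
    refine Finset.sum_le_sum fun i _ => ?_
    have h1 : (1 : ℝ) ≤ s i := by exact_mod_cast hs i
    have h2 : 0 ≤ ((s i : ℝ) - 1) * y (.inr (.inl i)) ^ 2 :=
      mul_nonneg (sub_nonneg.mpr h1) (sq_nonneg _)
    have h3 : 0 ≤ ε * ((s i : ℝ) * y (.inr (.inl i)) ^ 2) := by positivity
    nlinarith [sq_nonneg (y (.inl ()) - y (.inr (.inl i)))]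
  simp only [coreVectors, LinearMap.coe_mk, AddHom.coe_mk, Fintype.sum_sum_type, Fintype.sum_sigma,
    Sum.elim_inl, Sum.elim_inr, Finset.sum_const, Finset.card_univ, Fintype.card_unit,
    Fintype.card_fin, Nat.cast_one, one_mul, nsmul_eq_mul, neg_sq, sub_neg_eq_add, ← two_mul]
  have h1 : (1 : ℝ) ≤ t := by exact_mod_cast ht
  have h2 : 0 ≤ ((t : ℝ) - 1) * y (.inr (.inr ())) ^ 2 :=
    mul_nonneg (sub_nonneg.mpr h1) (sq_nonneg _)
  have h3 : 0 ≤ ε * ((t : ℝ) * y (.inr (.inr ())) ^ 2) := by positivity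
  have h4 : 0 ≤ (q : ℝ) * y (.inl ()) ^ 2 := by positivity
  have h5 : 0 ≤ ε * ((q : ℝ) * y (.inl ()) ^ 2) := by positivity
  have h6 : 0 ≤ ε * y (.inl ()) ^ 2 := by positivity
  have h7 := mul_pos hε hpos
  have h8 := sq_nonneg (-y (.inl ()) - y (.inr (.inr ())))
  linarith

theorem dotProduct_lapMatrix_mulVec_leafVectors_lt (q m t : ℕ) (s : Fin m → ℕ) {x : ℝ} (hx : 1 < x)
    (y : Fin q ⊕ (Σ i : Fin m, Fin (s i)) ⊕ Fin t → ℝ) (hy : y ≠ 0) :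
    leafVectors q m t s y ⬝ᵥ
        (((diam5Tree q m t s).lapMatrix ℝ).mulVec (leafVectors q m t s y)) <
      x * ∑ v, leafVectors q m t s y v ^ 2 := by
  rw [dotProduct_lapMatrix_mulVec_diam5Tree]
  have hpos : 0 < ∑ k, y k ^ 2 := by
    obtain ⟨k, hk⟩ := Function.ne_iff.mp hy
    exact Finset.sum_pos' (fun _ _ => sq_nonneg _) ⟨k, Finset.mem_univ k, sq_pos_of_ne_zero hk⟩
  simp only [Fintype.sum_sum_type, Fintype.sum_sigma] at hpos
  simp only [leafVectors, LinearMap.coe_mk, AddHom.coe_mk, Fintype.sum_sum_type, Fintype.sum_sigma,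
    Sum.elim_inl, Sum.elim_inr, Finset.univ_unique, Finset.sum_singleton, zero_sub, neg_sq,
    sub_zero, ne_eq, OfNat.ofNat_ne_zero, not_false_eq_true, zero_pow, zero_add, add_zero]
  linarith [mul_pos (sub_pos.mpr hx) hpos]

/-- Let `T` be the diameter-5 tree whose root is adjacent to `p ≥ 0` leaves,
to `r - 1 ≥ 1` vertices `v₁, …, v_{r-1}` each additionally adjacent to `s_i ≥ 1` leaves,
and to exactly one vertex `w'` whose only other neighbour `w` is additionally adjacent to
`t ≥ 1` leaves, so that `n = p + r + 2 + t + s₁ + ⋯ + s_{r-1}`. If `σ` is the number of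
Laplacian eigenvalues of `T` strictly larger than the average degree `2 - 2/n`, then
`σ = r + 1` or `σ = r + 2`. -/
theorem sigma_diam5Tree (p r t : ℕ) (hr : 2 ≤ r) (ht : 1 ≤ t)
    (s : Fin (r - 1) → ℕ) (hs : ∀ i, 1 ≤ s i)
    (n : ℕ) (hn : n = p + r + 2 + t + ∑ i, s i) (σ : ℕ)
    (hσ : σ = Multiset.card
      ((lapSpectrum (diam5Tree p (r - 1) t s)).filter (fun x => 2 - 2 / (n : ℝ) < x))) :
    σ = r + 1 ∨ σ = r + 2 := by
  subst hσ
  have hε : 0 < 2 / (n : ℝ) := by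
    have : 0 < n := by omega
    positivity
  have hx : 1 < 2 - 2 / (n : ℝ) := by
    have h2 : (2 : ℝ) < n := by exact_mod_cast (show 2 < n by omega)
    have := (div_lt_one (by linarith)).mpr h2
    linarith
  have hA := (diam5Tree p (r - 1) t s).isHermitian_lapMatrix (R := ℝ)
  have hlower := card_le_card_filter_roots_of_posDef hA (2 - 2 / (n : ℝ)) _
    (lt_dotProduct_lapMatrix_mulVec_coreVectors p (r - 1) t s ht hs hε)
  have hupper := card_filter_roots_add_card_le_of_negDef hA (2 - 2 / (n : ℝ)) _
    (dotProduct_lapMatrix_mulVec_leafVectors_lt p (r - 1) t s hx)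
  simp only [Fintype.card_sum, Fintype.card_unit, Fintype.card_fin, Fintype.card_sigma,
    Finset.sum_add_distrib, Finset.sum_const, Finset.card_univ, smul_eq_mul, mul_one] at hlower hupper
  unfold lapSpectrum
  omega

end LapPaper
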